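/- Let n ≥ 2, δ > 0, and μ > 0. Suppose V ∈ C¹(D) ∩ L^∞(D) satisfies V > 0 on D and t·∂_t V + r·∂_r V > (−2+μ)·V everywhere on D. Suppose φ ∈ C²(D) satisfies □φ + V·φ = 0 on D, satisfies the decay condition Dec(δ), and satisfies sup_{D∩{|uv|>1}} [(1+|u|)(1+|v|)]^{(n−1+δ)/2} |uv|^{1/2} V^{1/2} |φ| < ∞. Then φ = 0 everywhere on D. -/

import Mathlib

open Real MeasureTheory
open scoped BigOperators

noncomputable section

/-- Minkowski spacetime `ℝ^{1+n}`, with coordinates `(t, x)`. -/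
abbrev Spacetime (n : ℕ) := ℝ × EuclideanSpace ℝ (Fin n)

/-- The exterior `D` of the light cone: `{(t,x) : |t| < |x|}`. -/
def Dom (n : ℕ) : Set (Spacetime n) := {p | |p.1| < ‖p.2‖}

/-- Partial derivative in the time direction. -/
def dt {n : ℕ} (φ : Spacetime n → ℝ) (p : Spacetime n) : ℝ :=
  fderiv ℝ φ p (1, 0)

/-- Partial derivative in the `i`-th spatial direction. -/
def dx {n : ℕ} (i : Fin n) (φ : Spacetime n → ℝ) (p : Spacetime n) : ℝ :=
  fderiv ℝ φ p (0, EuclideanSpace.single i 1)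

/-- The wave operator `□φ = −∂²_t φ + Δ_x φ`. -/
def box {n : ℕ} (φ : Spacetime n → ℝ) (p : Spacetime n) : ℝ :=
  - dt (dt φ) p + ∑ i, dx i (dx i φ) p

/-- Null coordinate `u = (t − r)/2`. -/
def uu {n : ℕ} (p : Spacetime n) : ℝ := (p.1 - ‖p.2‖) / 2

/-- Null coordinate `v = (t + r)/2`. -/
def vv {n : ℕ} (p : Spacetime n) : ℝ := (p.1 + ‖p.2‖) / 2

/-- Radial derivative `∂_r φ = (x/|x|)·∇_x φ`. -/
def dr {n : ℕ} (φ : Spacetime n → ℝ) (p : Spacetime n) : ℝ :=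
  (∑ i, p.2 i * dx i φ p) / ‖p.2‖

/-- `∂_u φ := ∂_t φ − ∂_r φ`. -/
def du {n : ℕ} (φ : Spacetime n → ℝ) (p : Spacetime n) : ℝ := dt φ p - dr φ p

/-- `∂_v φ := ∂_t φ + ∂_r φ`. -/
def dv {n : ℕ} (φ : Spacetime n → ℝ) (p : Spacetime n) : ℝ := dt φ p + dr φ p

/-- The squared angular gradient `|∇̸φ|² = |∇_x φ|² − (∂_r φ)²`. -/
def angSq {n : ℕ} (φ : Spacetime n → ℝ) (p : Spacetime n) : ℝ :=
  (∑ i, (dx i φ p) ^ 2) - (dr φ p) ^ 2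

/-- The decay condition `Dec(γ)` on `D`. -/
def Dec {n : ℕ} (γ : ℝ) (φ : Spacetime n → ℝ) : Prop :=
  (∃ C : ℝ, ∀ p ∈ Dom n,
    ((1 + |uu p|) * (1 + |vv p|)) ^ (((n : ℝ) - 1 + γ) / 2) *
      (|uu p * du φ p| + |vv p * dv φ p|) ≤ C) ∧
  (∃ C : ℝ, ∀ p ∈ Dom n, |uu p * vv p| < 1 →
    ((1 + |uu p|) * (1 + |vv p|)) ^ (((n : ℝ) - 1 + γ) / 2) *
      |uu p * vv p| ^ ((1 : ℝ) / 2) * Real.sqrt (angSq φ p) ≤ C) ∧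
  (∃ C : ℝ, ∀ p ∈ Dom n,
    ((1 + |uu p|) * (1 + |vv p|)) ^ (((n : ℝ) - 1 + γ) / 2) * |φ p| ≤ C)



/-- one-dimensional weight -/
def kk (ε δ : ℝ) (a : ℝ) : ℝ :=
  (Set.Ioi (0:ℝ)).indicator (fun a => a ^ (ε - 1) * (1 + a / 2) ^ (-δ)) a

lemma kk_nonneg (ε δ a : ℝ) : 0 ≤ kk ε δ a := by
  unfold kk
  apply Set.indicator_nonneg
  intro x hx
  have hx' : (0:ℝ) < x := hx
  positivity

lemma kk_meas (ε δ : ℝ) : Measurable (kk ε δ) := by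
  unfold kk
  apply Measurable.indicator _ measurableSet_Ioi
  fun_prop

lemma kk_integrable {ε δ : ℝ} (hε : 0 < ε) (hεδ : ε < δ) : Integrable (kk ε δ) := by
  have h1 : IntegrableOn (fun a : ℝ => a ^ (ε - 1)) (Set.Ioc 0 1) :=
    (intervalIntegrable_iff_integrableOn_Ioc_of_le zero_le_one).1
      (intervalIntegral.intervalIntegrable_rpow' (by linarith))
  have h2 : IntegrableOn (fun a : ℝ => a ^ (ε - 1 - δ)) (Set.Ioi 1) :=
    integrableOn_Ioi_rpow_of_lt (by linarith) one_pos
  have hδ : 0 < δ := hε.trans hεδ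
  have hm : Measurable (fun a : ℝ => a ^ (ε - 1) * (1 + a / 2) ^ (-δ)) := by fun_prop
  have h3 : IntegrableOn (fun a : ℝ => a ^ (ε - 1) * (1 + a / 2) ^ (-δ)) (Set.Ioc 0 1) := by
    refine Integrable.mono' h1 hm.aestronglyMeasurable ?_
    refine (ae_restrict_iff' measurableSet_Ioc).2 (Filter.Eventually.of_forall fun a ha => ?_)
    have ha0 : 0 < a := ha.1
    have : (1 + a / 2) ^ (-δ) ≤ 1 := rpow_le_one_of_one_le_of_nonpos (by linarith) (by linarith)
    rw [Real.norm_of_nonneg (by positivity)]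
    have := mul_le_mul_of_nonneg_left this (rpow_nonneg ha0.le (ε - 1))
    linarith
  have h4 : IntegrableOn (fun a : ℝ => a ^ (ε - 1) * (1 + a / 2) ^ (-δ)) (Set.Ioi 1) := by
    refine Integrable.mono' (h2.const_mul (2 ^ δ)) hm.aestronglyMeasurable ?_
    refine (ae_restrict_iff' measurableSet_Ioi).2 (Filter.Eventually.of_forall fun a ha => ?_)
    have ha1 : 1 < a := ha
    have ha0 : 0 < a := by linarith
    rw [Real.norm_of_nonneg (by positivity)]
    have : (1 + a / 2) ^ (-δ) ≤ (a / 2) ^ (-δ) :=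
      rpow_le_rpow_of_nonpos (by linarith) (by linarith) (by linarith)
    calc a ^ (ε - 1) * (1 + a / 2) ^ (-δ) ≤ a ^ (ε - 1) * (a / 2) ^ (-δ) := by gcongr
      _ = 2 ^ δ * a ^ (ε - 1 - δ) := by
        rw [div_rpow ha0.le (by norm_num), sub_eq_add_neg (ε - 1), rpow_add ha0,
          rpow_neg (by norm_num : (0:ℝ) ≤ 2)]
        field_simp
  have h5 := h3.union h4
  rw [Set.Ioc_union_Ioi_eq_Ioi zero_le_one] at h5
  exact (integrable_indicator_iff measurableSet_Ioi).2 h5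

lemma kk_prod_integrable {ε δ : ℝ} (hε : 0 < ε) (hεδ : ε < δ) :
    Integrable (fun z : ℝ × ℝ => kk ε δ (z.2 - z.1) * kk ε δ (z.2 + z.1)) := by
  have h := (kk_integrable hε hεδ).mul_prod (kk_integrable hε hεδ)
  let L : (ℝ × ℝ) ≃ₗ[ℝ] (ℝ × ℝ) :=
    { toFun := fun z => (z.2 - z.1, z.2 + z.1)
      invFun := fun w => ((w.2 - w.1) / 2, (w.2 + w.1) / 2)
      map_add' := by intro a b; ext <;> simp <;> ring
      map_smul' := by intro a b; ext <;> simp <;> ring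
      left_inv := by intro a; ext <;> simp
      right_inv := by intro a; ext <;> simp <;> ring }
  have hdet : LinearMap.det (L : (ℝ × ℝ) →ₗ[ℝ] (ℝ × ℝ)) ≠ 0 := (LinearEquiv.isUnit_det' L).ne_zero
  have hmap := Measure.map_linearMap_addHaar_eq_smul_addHaar (volume : Measure (ℝ × ℝ)) hdet
  have h' : Integrable (fun z : ℝ × ℝ => kk ε δ z.1 * kk ε δ z.2)
      (Measure.map (L : (ℝ × ℝ) →ₗ[ℝ] (ℝ × ℝ)) volume) := by
    rw [hmap]
    exact h.smul_measure ENNReal.ofReal_ne_top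
  have hLm : Measurable (L : (ℝ × ℝ) →ₗ[ℝ] (ℝ × ℝ)) := by
    change Measurable (fun z : ℝ × ℝ => (z.2 - z.1, z.2 + z.1))
    fun_prop
  exact h'.comp_measurable hLm

/-- radial profile -/
def gprof (n : ℕ) (ε δ : ℝ) (t y : ℝ) : ℝ :=
  if |t| < y then (y ^ 2 - t ^ 2) ^ (ε - 1) *
    ((1 + |(t - y) / 2|) * (1 + |(t + y) / 2|)) ^ (-((n : ℝ) - 1 + δ)) else 0

lemma gprof_nonneg (n : ℕ) (ε δ t y : ℝ) : 0 ≤ gprof n ε δ t y := by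
  unfold gprof
  split_ifs with h
  · have : 0 ≤ y ^ 2 - t ^ 2 := by nlinarith [abs_nonneg t, sq_abs t]
    positivity
  · exact le_rfl

lemma gprof_meas (n : ℕ) (ε δ : ℝ) : Measurable (fun z : ℝ × ℝ => gprof n ε δ z.1 z.2) := by
  unfold gprof
  apply Measurable.ite
  · exact measurableSet_lt (by fun_prop) (by fun_prop)
  · fun_prop
  · fun_prop

lemma gprof_le (n : ℕ) (hn : 2 ≤ n) {ε δ : ℝ} (_hδ : 0 < δ) (t y : ℝ) (hy : 0 < y) :
    y ^ (n - 1) * gprof n ε δ t y ≤ kk ε δ (y - t) * kk ε δ (y + t) := by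
  unfold gprof
  split_ifs with h
  · have h1 : 0 < y - t := by linarith [le_abs_self t]
    have h2 : 0 < y + t := by linarith [neg_abs_le t]
    have e1 : kk ε δ (y - t) = (y - t) ^ (ε - 1) * (1 + (y - t) / 2) ^ (-δ) :=
      Set.indicator_of_mem (show y - t ∈ Set.Ioi (0:ℝ) from h1) _
    have e2 : kk ε δ (y + t) = (y + t) ^ (ε - 1) * (1 + (y + t) / 2) ^ (-δ) :=
      Set.indicator_of_mem (show y + t ∈ Set.Ioi (0:ℝ) from h2) _
    rw [e1, e2]
    have a1 : |(t - y) / 2| = (y - t) / 2 := by rw [abs_of_neg (by linarith)]; ring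
    have a2 : |(t + y) / 2| = (y + t) / 2 := by rw [abs_of_pos (by linarith)]; ring
    rw [a1, a2, show y ^ 2 - t ^ 2 = (y - t) * (y + t) by ring, mul_rpow h1.le h2.le]
    set w := (1 + (y - t) / 2) * (1 + (y + t) / 2) with hw
    have hwy : y ≤ w := by rw [hw]; nlinarith
    have hw0 : 0 < w := by positivity
    have e3 : (1 + (y - t) / 2) ^ (-δ) * (1 + (y + t) / 2) ^ (-δ) = w ^ (-δ) := by
      rw [hw, mul_rpow (by positivity) (by positivity)]
    have e4 : w ^ (-((n:ℝ) - 1 + δ)) = (w ^ (n - 1))⁻¹ * w ^ (-δ) := by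
      rw [neg_add, rpow_add hw0, rpow_neg hw0.le, ← rpow_natCast, Nat.cast_sub (by omega)]
      simp
    have e5 : y ^ (n - 1) * (w ^ (n - 1))⁻¹ ≤ 1 := by
      rw [← div_eq_mul_inv, div_le_one (by positivity)]
      gcongr
    calc y ^ (n - 1) * ((y - t) ^ (ε - 1) * (y + t) ^ (ε - 1) * w ^ (-((n:ℝ) - 1 + δ)))
        = (y ^ (n - 1) * (w ^ (n - 1))⁻¹) * ((y - t) ^ (ε - 1) * (y + t) ^ (ε - 1) * w ^ (-δ)) := by
          rw [e4]; ring
      _ ≤ 1 * ((y - t) ^ (ε - 1) * (y + t) ^ (ε - 1) * w ^ (-δ)) := by gcongr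
      _ = _ := by rw [← e3]; ring
  · rw [mul_zero]
    exact mul_nonneg (kk_nonneg _ _ _) (kk_nonneg _ _ _)

/-- the dominating weight on spacetime -/
def gg (n : ℕ) (ε δ : ℝ) (p : Spacetime n) : ℝ := gprof n ε δ p.1 ‖p.2‖

lemma gg_integrable (n : ℕ) (hn : 2 ≤ n) {ε δ : ℝ} (hε : 0 < ε) (hεδ : ε < δ) :
    Integrable (gg n ε δ) := by
  have hδ : 0 < δ := hε.trans hεδ
  have : Nontrivial (EuclideanSpace ℝ (Fin n)) := by
    have : Nonempty (Fin n) := ⟨⟨0, by omega⟩⟩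
    infer_instance
  have hfr : Module.finrank ℝ (EuclideanSpace ℝ (Fin n)) = n := by simp
  have hK : Integrable (fun z : ℝ × ℝ =>
      (Set.Ioi (0:ℝ)).indicator (fun y => y ^ (n - 1) * gprof n ε δ z.1 y) z.2) := by
    refine (kk_prod_integrable hε hεδ).mono' ?_ (Filter.Eventually.of_forall fun z => ?_)
    · apply Measurable.aestronglyMeasurable
      have : (fun z : ℝ × ℝ =>
          (Set.Ioi (0:ℝ)).indicator (fun y => y ^ (n - 1) * gprof n ε δ z.1 y) z.2)
          = (Prod.snd ⁻¹' (Set.Ioi (0:ℝ))).indicator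
            (fun z : ℝ × ℝ => z.2 ^ (n - 1) * gprof n ε δ z.1 z.2) := by
        ext z; rfl
      rw [this]
      exact Measurable.indicator ((measurable_snd.pow_const _).mul (gprof_meas n ε δ))
        (measurable_snd measurableSet_Ioi)
    · by_cases hz : z.2 ∈ Set.Ioi (0:ℝ)
      · rw [Set.indicator_of_mem hz]
        have hz' : 0 < z.2 := hz
        rw [Real.norm_of_nonneg (mul_nonneg (by positivity) (gprof_nonneg _ _ _ _ _))]
        exact gprof_le n hn hδ z.1 z.2 hz'
      · rw [Set.indicator_of_notMem hz, norm_zero]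
        exact mul_nonneg (kk_nonneg _ _ _) (kk_nonneg _ _ _)
  have hmeas : Measurable (gg n ε δ) := by
    unfold gg
    exact (gprof_meas n ε δ).comp (measurable_fst.prodMk measurable_snd.norm)
  change Integrable (gg n ε δ) ((volume : Measure ℝ).prod volume)
  rw [integrable_prod_iff hmeas.aestronglyMeasurable]
  constructor
  · filter_upwards [hK.prod_right_ae] with t ht
    change Integrable (fun x : EuclideanSpace ℝ (Fin n) => gprof n ε δ t ‖x‖)
    rw [integrable_fun_norm_addHaar volume (f := fun y => gprof n ε δ t y), hfr]
    exact (integrable_indicator_iff measurableSet_Ioi).1 ht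
  · have := hK.integral_prod_left
    have e : (fun t : ℝ => ∫ x : EuclideanSpace ℝ (Fin n), ‖gg n ε δ (t, x)‖) =
        fun t => n • (volume : Measure (EuclideanSpace ℝ (Fin n))).real (Metric.ball 0 1) •
          ∫ y, (Set.Ioi (0:ℝ)).indicator (fun y => y ^ (n - 1) * gprof n ε δ t y) y := by
      ext t
      have : (fun x : EuclideanSpace ℝ (Fin n) => ‖gg n ε δ (t, x)‖) =
          fun x => gprof n ε δ t ‖x‖ := by
        ext x; exact Real.norm_of_nonneg (gprof_nonneg _ _ _ _ _)
      rw [this, integral_fun_norm_addHaar volume (fun y => gprof n ε δ t y), hfr,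
        integral_indicator measurableSet_Ioi]
      simp
    rw [e]
    simp only [nsmul_eq_mul, smul_eq_mul]
    exact (this.const_mul _).const_mul _


/-- coordinate basis of spacetime -/
def EE {n : ℕ} : Option (Fin n) → Spacetime n
  | none => (1, 0)
  | some i => (0, EuclideanSpace.single i 1)

/-- coordinates, as continuous linear maps -/
def yy {n : ℕ} : Option (Fin n) → (Spacetime n →L[ℝ] ℝ)
  | none => ContinuousLinearMap.fst ℝ ℝ (EuclideanSpace ℝ (Fin n))
  | some i => (EuclideanSpace.proj i).comp (ContinuousLinearMap.snd ℝ ℝ (EuclideanSpace ℝ (Fin n)))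

/-- metric signs -/
def mm {n : ℕ} : Option (Fin n) → ℝ
  | none => -1
  | some _ => 1

/-- partial derivatives -/
def DD {n : ℕ} (α : Option (Fin n)) (f : Spacetime n → ℝ) (p : Spacetime n) : ℝ :=
  fderiv ℝ f p (EE α)

@[simp] lemma yy_none {n : ℕ} (p : Spacetime n) : yy none p = p.1 := rfl
@[simp] lemma yy_some {n : ℕ} (i : Fin n) (p : Spacetime n) : yy (some i) p = p.2 i := rfl

lemma mm_sq {n : ℕ} (α : Option (Fin n)) : mm α * mm α = 1 := by
  cases α <;> simp [mm]

lemma yy_EE {n : ℕ} (α β : Option (Fin n)) : yy α (EE β) = if α = β then 1 else 0 := by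
  cases α <;> cases β <;> simp [EE]

lemma sum_yy {n : ℕ} (p : Spacetime n) : ∑ α, yy α p • EE α = p := by
  rw [Fintype.sum_option]
  ext i
  · simp [EE, Prod.fst_sum]
  · simp [EE, Prod.snd_sum, Pi.single_apply]

lemma lin_apply {n : ℕ} (L : Spacetime n →L[ℝ] ℝ) (p : Spacetime n) :
    L p = ∑ α, yy α p * L (EE α) := by
  conv_lhs => rw [← sum_yy p]
  simp

/-- the quantity `r² - t²` -/
def RR {n : ℕ} (p : Spacetime n) : ℝ := ‖p.2‖ ^ 2 - p.1 ^ 2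

lemma RR_eq {n : ℕ} (p : Spacetime n) : RR p = ∑ α, mm α * (yy α p * yy α p) := by
  rw [Fintype.sum_option, RR, EuclideanSpace.norm_sq_eq]
  simp [mm]
  ring_nf

lemma RR_pos {n : ℕ} {p : Spacetime n} (hp : p ∈ Dom n) : 0 < RR p := by
  have : |p.1| < ‖p.2‖ := hp
  unfold RR
  nlinarith [abs_nonneg p.1, sq_abs p.1]

lemma isOpen_Dom (n : ℕ) : IsOpen (Dom n) :=
  isOpen_lt (by fun_prop) (by fun_prop)

lemma RR_contDiff {n : ℕ} : ContDiff ℝ 2 (RR (n := n)) := by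
  unfold RR
  exact (contDiff_snd.norm_sq ℝ).sub (contDiff_fst.pow 2)

/-- gradient vector (index raised) -/
def GG {n : ℕ} (φ : Spacetime n → ℝ) (p : Spacetime n) : Spacetime n :=
  ∑ α, (mm α * DD α φ p) • EE α

lemma yy_GG {n : ℕ} (φ : Spacetime n → ℝ) (p : Spacetime n) (α : Option (Fin n)) :
    yy α (GG φ p) = mm α * DD α φ p := by
  rw [GG, map_sum]
  simp only [map_smul, yy_EE, smul_eq_mul, mul_ite, mul_one, mul_zero]
  simp only [Finset.sum_ite_eq, Finset.mem_univ, if_true]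

lemma fderiv_GG {n : ℕ} (φ f : Spacetime n → ℝ) (p : Spacetime n) :
    fderiv ℝ f p (GG φ p) = ∑ α, mm α * DD α φ p * DD α f p := by
  simp [GG, DD]

lemma fderiv_self {n : ℕ} (f : Spacetime n → ℝ) (p : Spacetime n) :
    fderiv ℝ f p p = ∑ α, yy α p * DD α f p := lin_apply _ _

lemma fderiv_RR {n : ℕ} (p v : Spacetime n) :
    fderiv ℝ RR p v = 2 * ∑ α, mm α * (yy α p * yy α v) := by
  have h : HasFDerivAt (fun q : Spacetime n => ∑ α, mm α * (yy α q * yy α q))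
      (∑ α, mm α • (yy α p • (yy α : Spacetime n →L[ℝ] ℝ) + yy α p • yy α)) p := by
    apply HasFDerivAt.fun_sum
    intro α _
    exact (((yy α).hasFDerivAt.mul (yy α).hasFDerivAt).const_mul (mm α))
  have e : (RR : Spacetime n → ℝ) = fun q => ∑ α, mm α * (yy α q * yy α q) := funext RR_eq
  rw [e, h.fderiv]
  simp only [sum_apply, smul_apply,
    add_apply, smul_eq_mul, Finset.mul_sum]
  exact Finset.sum_congr rfl fun α _ => by ring

lemma fderiv_RR_self {n : ℕ} (p : Spacetime n) : fderiv ℝ RR p p = 2 * RR p := by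
  rw [fderiv_RR, RR_eq]

lemma fderiv_RR_GG {n : ℕ} (φ : Spacetime n → ℝ) (p : Spacetime n) :
    fderiv ℝ RR p (GG φ p) = 2 * fderiv ℝ φ p p := by
  rw [fderiv_RR, fderiv_self]
  congr 1
  refine Finset.sum_congr rfl fun α _ => ?_
  rw [yy_GG]
  linear_combination yy α p * DD α φ p * mm_sq α

lemma fderiv_mul_app {n : ℕ} {f g : Spacetime n → ℝ} {p : Spacetime n}
    (hf : DifferentiableAt ℝ f p) (hg : DifferentiableAt ℝ g p) (v : Spacetime n) :
    fderiv ℝ (fun q => f q * g q) p v = f p * fderiv ℝ g p v + g p * fderiv ℝ f p v := by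
  rw [fderiv_fun_mul hf hg]
  simp

lemma div_X {n : ℕ} {f : Spacetime n → ℝ} {p : Spacetime n} (hf : DifferentiableAt ℝ f p) :
    ∑ α, DD α (fun q => f q * yy α q) p = fderiv ℝ f p p + ((n : ℝ) + 1) * f p := by
  have : ∀ α, DD α (fun q => f q * yy α q) p = f p + yy α p * DD α f p := by
    intro α
    unfold DD
    rw [fderiv_mul_app hf (yy α).differentiableAt, ContinuousLinearMap.fderiv, yy_EE]
    simp
  simp only [this, Finset.sum_add_distrib, fderiv_self]
  simp
  ring

lemma box_eq {n : ℕ} (φ : Spacetime n → ℝ) (p : Spacetime n) :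
    box φ p = ∑ α, mm α * DD α (DD α φ) p := by
  rw [Fintype.sum_option]
  simp only [mm, box, neg_mul, one_mul]
  rfl

lemma div_G {n : ℕ} {φ f : Spacetime n → ℝ} {p : Spacetime n} (hf : DifferentiableAt ℝ f p)
    (hφ : ∀ α, DifferentiableAt ℝ (DD α φ) p) :
    ∑ α, DD α (fun q => f q * (mm α * DD α φ q)) p
      = fderiv ℝ f p (GG φ p) + f p * box φ p := by
  rw [fderiv_GG, box_eq, Finset.mul_sum, ← Finset.sum_add_distrib]
  refine Finset.sum_congr rfl fun α _ => ?_
  have : DD α (fun q => f q * (mm α * DD α φ q)) p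
      = f p * fderiv ℝ (fun q => mm α * DD α φ q) p (EE α) + (mm α * DD α φ p) * DD α f p :=
    fderiv_mul_app hf ((hφ α).const_mul _) _
  rw [this, fderiv_const_mul (hφ α)]
  simp [DD]
  ring

/-- the quadratic form of the gradient -/
def BB {n : ℕ} (φ : Spacetime n → ℝ) (p : Spacetime n) : ℝ := ∑ α, mm α * (DD α φ p * DD α φ p)

lemma fderiv_BB {n : ℕ} {φ : Spacetime n → ℝ} {p : Spacetime n}
    (hφ : ∀ α, DifferentiableAt ℝ (DD α φ) p) (v : Spacetime n) :
    fderiv ℝ (BB φ) p v = 2 * ∑ α, mm α * DD α φ p * fderiv ℝ (DD α φ) p v := by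
  have h : HasFDerivAt (BB φ)
      (∑ α, mm α • (DD α φ p • fderiv ℝ (DD α φ) p + DD α φ p • fderiv ℝ (DD α φ) p)) p := by
    apply HasFDerivAt.fun_sum
    intro α _
    exact (((hφ α).hasFDerivAt.mul (hφ α).hasFDerivAt).const_mul (mm α))
  rw [h.fderiv]
  simp only [sum_apply, smul_apply,
    add_apply, smul_eq_mul, Finset.mul_sum]
  exact Finset.sum_congr rfl fun α _ => by ring

/-- scaling derivative -/
def SS {n : ℕ} (φ : Spacetime n → ℝ) (p : Spacetime n) : ℝ := fderiv ℝ φ p p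

lemma fderiv_SS {n : ℕ} {φ : Spacetime n → ℝ} {p : Spacetime n}
    (hφ : ∀ α, DifferentiableAt ℝ (DD α φ) p) (v : Spacetime n) :
    fderiv ℝ (SS φ) p v = ∑ α, (yy α p * fderiv ℝ (DD α φ) p v + DD α φ p * yy α v) := by
  have h : HasFDerivAt (SS φ)
      (∑ α, (yy α p • fderiv ℝ (DD α φ) p + DD α φ p • (yy α : Spacetime n →L[ℝ] ℝ))) p := by
    have e : SS φ = fun q => ∑ α, yy α q * DD α φ q := funext fun q => fderiv_self φ q
    rw [e]
    apply HasFDerivAt.fun_sum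
    intro α _
    exact ((yy α).hasFDerivAt.mul (hφ α).hasFDerivAt)
  rw [h.fderiv]
  simp

lemma DD_symm {n : ℕ} {φ : Spacetime n → ℝ} {p : Spacetime n} (hφ : ContDiffAt ℝ 2 φ p)
    (α β : Option (Fin n)) : DD α (DD β φ) p = DD β (DD α φ) p := by
  have hs : IsSymmSndFDerivAt ℝ φ p := hφ.isSymmSndFDerivAt (by simp)
  have hd : DifferentiableAt ℝ (fderiv ℝ φ) p :=
    (hφ.fderiv_right (m := 1) (by norm_num)).differentiableAt (by norm_num)
  have key : ∀ α β : Option (Fin n), DD α (DD β φ) p = fderiv ℝ (fderiv ℝ φ) p (EE α) (EE β) := by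
    intro α β
    unfold DD
    have : HasFDerivAt (fun q => fderiv ℝ φ q (EE β))
      ((ContinuousLinearMap.apply ℝ ℝ (EE β)).comp (fderiv ℝ (fderiv ℝ φ) p)) p :=
      (ContinuousLinearMap.apply ℝ ℝ (EE β)).hasFDerivAt.comp p hd.hasFDerivAt
    rw [this.fderiv]
    rfl
  rw [key, key]
  exact hs _ _

lemma DD_contDiffAt {n : ℕ} {φ : Spacetime n → ℝ} {p : Spacetime n} (hφ : ContDiffAt ℝ 2 φ p)
    (α : Option (Fin n)) : ContDiffAt ℝ 1 (DD α φ) p :=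
  (hφ.fderiv_right (m := 1) (by norm_num)).clm_apply contDiffAt_const

/-- the commutator identity -/
lemma SS_BB {n : ℕ} {φ : Spacetime n → ℝ} {p : Spacetime n} (hφ : ContDiffAt ℝ 2 φ p) :
    fderiv ℝ (SS φ) p (GG φ p) = BB φ p + (1 / 2) * fderiv ℝ (BB φ) p p := by
  have hd : ∀ α, DifferentiableAt ℝ (DD α φ) p := fun α =>
    (DD_contDiffAt hφ α).differentiableAt (by norm_num)
  rw [fderiv_SS hd, fderiv_BB hd, Finset.sum_add_distrib, add_comm]
  congr 1
  · unfold BB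
    exact Finset.sum_congr rfl fun α _ => by rw [yy_GG]; ring
  · have h1 : ∀ α, fderiv ℝ (DD α φ) p (GG φ p) = ∑ β, mm β * DD β φ p * DD β (DD α φ) p :=
      fun α => fderiv_GG _ _ _
    have h2 : ∀ α, fderiv ℝ (DD α φ) p p = ∑ β, yy β p * DD β (DD α φ) p :=
      fun α => fderiv_self _ _
    simp only [h1, h2, Finset.mul_sum]
    rw [Finset.sum_comm]
    refine Finset.sum_congr rfl fun α _ => Finset.sum_congr rfl fun β _ => ?_
    rw [DD_symm hφ α β]
    ring


/-- coefficient of the dilation field -/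
def AA {n : ℕ} (ε l : ℝ) (V φ : Spacetime n → ℝ) (q : Spacetime n) : ℝ :=
  l * ε * (RR q ^ (ε - 1) * (φ q * φ q)) + 1 / 2 * (RR q ^ ε * (V q * (φ q * φ q) - BB φ q))

/-- coefficient of the gradient field -/
def FF {n : ℕ} (ε l : ℝ) (φ : Spacetime n → ℝ) (q : Spacetime n) : ℝ :=
  RR q ^ ε * (SS φ q + l * φ q)

lemma BB_contDiffAt {n : ℕ} {φ : Spacetime n → ℝ} {p : Spacetime n} (hφ : ContDiffAt ℝ 2 φ p) :
    ContDiffAt ℝ 1 (BB φ) p := by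
  unfold BB
  apply ContDiffAt.sum
  intro α _
  exact contDiffAt_const.mul ((DD_contDiffAt hφ α).mul (DD_contDiffAt hφ α))

lemma SS_contDiffAt {n : ℕ} {φ : Spacetime n → ℝ} {p : Spacetime n} (hφ : ContDiffAt ℝ 2 φ p) :
    ContDiffAt ℝ 1 (SS φ) p :=
  (hφ.fderiv_right (m := 1) (by norm_num)).clm_apply contDiffAt_id

lemma RR_rpow_contDiffAt {n : ℕ} {p : Spacetime n} (hp : p ∈ Dom n) (a : ℝ) :
    ContDiffAt ℝ 1 (fun q : Spacetime n => RR q ^ a) p :=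
  (RR_contDiff.contDiffAt.of_le (by norm_num)).rpow_const_of_ne (RR_pos hp).ne'

lemma AA_contDiffAt {n : ℕ} {ε l : ℝ} {V φ : Spacetime n → ℝ} {p : Spacetime n} (hp : p ∈ Dom n)
    (hφ : ContDiffAt ℝ 2 φ p) (hV : ContDiffAt ℝ 1 V p) : ContDiffAt ℝ 1 (AA ε l V φ) p := by
  have hφ1 : ContDiffAt ℝ 1 φ p := hφ.of_le (by norm_num)
  unfold AA
  exact (contDiffAt_const.mul ((RR_rpow_contDiffAt hp _).mul (hφ1.mul hφ1))).add
    (contDiffAt_const.mul ((RR_rpow_contDiffAt hp _).mul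
      ((hV.mul (hφ1.mul hφ1)).sub (BB_contDiffAt hφ))))

lemma FF_contDiffAt {n : ℕ} {ε l : ℝ} {φ : Spacetime n → ℝ} {p : Spacetime n} (hp : p ∈ Dom n)
    (hφ : ContDiffAt ℝ 2 φ p) : ContDiffAt ℝ 1 (FF ε l φ) p := by
  have hφ1 : ContDiffAt ℝ 1 φ p := hφ.of_le (by norm_num)
  unfold FF
  exact (RR_rpow_contDiffAt hp _).mul ((SS_contDiffAt hφ).add (contDiffAt_const.mul hφ1))

lemma fderiv_RR_rpow {n : ℕ} {p : Spacetime n} (hp : p ∈ Dom n) (a : ℝ) (v : Spacetime n) :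
    fderiv ℝ (fun q : Spacetime n => RR q ^ a) p v = a * RR p ^ (a - 1) * fderiv ℝ RR p v := by
  have h : DifferentiableAt ℝ (RR : Spacetime n → ℝ) p :=
    RR_contDiff.contDiffAt.differentiableAt (by norm_num)
  rw [(h.hasFDerivAt.rpow_const (Or.inl (RR_pos hp).ne')).fderiv]
  simp

lemma fderiv_AA {n : ℕ} {ε l : ℝ} {V φ : Spacetime n → ℝ} {p : Spacetime n} (hp : p ∈ Dom n)
    (hφ : ContDiffAt ℝ 2 φ p) (hV : ContDiffAt ℝ 1 V p) :
    fderiv ℝ (AA ε l V φ) p p =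
      l * ε * RR p ^ (ε - 1) * (2 * (ε - 1) * φ p ^ 2 + 2 * φ p * SS φ p)
      + 1 / 2 * RR p ^ ε * (2 * ε * (V p * φ p ^ 2 - BB φ p)
        + (SS V p * φ p ^ 2 + 2 * V p * φ p * SS φ p - fderiv ℝ (BB φ) p p)) := by
  have dφ : DifferentiableAt ℝ φ p := hφ.differentiableAt (by norm_num)
  have dV : DifferentiableAt ℝ V p := hV.differentiableAt (by norm_num)
  have dB : DifferentiableAt ℝ (BB φ) p := (BB_contDiffAt hφ).differentiableAt (by norm_num)
  have d1 := (RR_rpow_contDiffAt hp (ε - 1)).differentiableAt (by norm_num)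
  have d2 := (RR_rpow_contDiffAt hp ε).differentiableAt (by norm_num)
  have dff : DifferentiableAt ℝ (fun q => φ q * φ q) p := dφ.mul dφ
  have dVff : DifferentiableAt ℝ (fun q => V q * (φ q * φ q)) p := dV.mul dff
  have dW : DifferentiableAt ℝ (fun q => V q * (φ q * φ q) - BB φ q) p := dVff.sub dB
  have e1 := fderiv_mul_app d1 dff p
  have e2 := fderiv_mul_app d2 dW p
  have e3 := fderiv_mul_app dV dff p
  have e4 := fderiv_mul_app dφ dφ p
  have e5 : fderiv ℝ (fun q => V q * (φ q * φ q) - BB φ q) p p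
      = fderiv ℝ (fun q => V q * (φ q * φ q)) p p - fderiv ℝ (BB φ) p p := by
    rw [fderiv_fun_sub dVff dB]; rfl
  have e6 : fderiv ℝ (AA ε l V φ) p p = l * ε * fderiv ℝ (fun q => RR q ^ (ε - 1) * (φ q * φ q)) p p
      + 1 / 2 * fderiv ℝ (fun q => RR q ^ ε * (V q * (φ q * φ q) - BB φ q)) p p := by
    unfold AA
    rw [fderiv_fun_add ((d1.fun_mul dff).const_mul _) ((d2.fun_mul dW).const_mul _),
      fderiv_const_mul (d1.fun_mul dff), fderiv_const_mul (d2.fun_mul dW)]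
    rfl
  rw [e6, e1, e2, e5, e3, e4, fderiv_RR_rpow hp, fderiv_RR_rpow hp, fderiv_RR_self]
  have hR := RR_pos hp
  have r1 : RR p ^ (ε - 1 - 1) * RR p = RR p ^ (ε - 1) := by
    rw [rpow_sub_one hR.ne' (ε - 1)]; field_simp
  have r2 : RR p ^ (ε - 1) * RR p = RR p ^ ε := by
    rw [rpow_sub_one hR.ne']; field_simp
  unfold SS
  linear_combination 2 * l * ε * (ε - 1) * φ p ^ 2 * r1
    + ε * (V p * φ p ^ 2 - BB φ p) * r2

lemma fderiv_FF {n : ℕ} {ε l : ℝ} {φ : Spacetime n → ℝ} {p : Spacetime n} (hp : p ∈ Dom n)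
    (hφ : ContDiffAt ℝ 2 φ p) :
    fderiv ℝ (FF ε l φ) p (GG φ p) =
      2 * ε * RR p ^ (ε - 1) * SS φ p * (SS φ p + l * φ p)
      + RR p ^ ε * ((1 + l) * BB φ p + 1 / 2 * fderiv ℝ (BB φ) p p) := by
  have dφ : DifferentiableAt ℝ φ p := hφ.differentiableAt (by norm_num)
  have dS : DifferentiableAt ℝ (SS φ) p := (SS_contDiffAt hφ).differentiableAt (by norm_num)
  have d2 := (RR_rpow_contDiffAt hp ε).differentiableAt (by norm_num)
  have dN : DifferentiableAt ℝ (fun q => SS φ q + l * φ q) p := dS.add (dφ.const_mul l)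
  have e1 : fderiv ℝ (FF ε l φ) p (GG φ p) = _ := fderiv_mul_app d2 dN (GG φ p)
  have e2 : fderiv ℝ (fun q => SS φ q + l * φ q) p (GG φ p)
      = fderiv ℝ (SS φ) p (GG φ p) + l * fderiv ℝ φ p (GG φ p) := by
    rw [fderiv_fun_add dS (dφ.const_mul l), fderiv_const_mul dφ]; rfl
  have e3 : fderiv ℝ φ p (GG φ p) = BB φ p := by
    rw [fderiv_GG]; unfold BB; exact Finset.sum_congr rfl fun α _ => by ring
  rw [e1, e2, SS_BB hφ, e3, fderiv_RR_rpow hp, fderiv_RR_GG]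
  unfold SS
  ring

/-- the cut-off current -/
def ZZ {n : ℕ} (ε l : ℝ) (V φ η : Spacetime n → ℝ) (α : Option (Fin n)) (q : Spacetime n) : ℝ :=
  η q * AA ε l V φ q * yy α q + η q * FF ε l φ q * (mm α * DD α φ q)

lemma ZZ_contDiffAt {n : ℕ} {ε l : ℝ} {V φ η : Spacetime n → ℝ} {p : Spacetime n} (hp : p ∈ Dom n)
    (hφ : ContDiffAt ℝ 2 φ p) (hV : ContDiffAt ℝ 1 V p) (hη : ContDiffAt ℝ 1 η p)
    (α : Option (Fin n)) : ContDiffAt ℝ 1 (ZZ ε l V φ η α) p := by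
  unfold ZZ
  exact ((hη.mul (AA_contDiffAt hp hφ hV)).mul (yy α).contDiff.contDiffAt).add
    ((hη.mul (FF_contDiffAt hp hφ)).mul (contDiffAt_const.mul (DD_contDiffAt hφ α)))

lemma div_ZZ {n : ℕ} {ε l : ℝ} {V φ η : Spacetime n → ℝ} {p : Spacetime n} (hp : p ∈ Dom n)
    (hl : l = ((n : ℝ) - 1) / 2 + ε)
    (hφ : ContDiffAt ℝ 2 φ p) (hV : ContDiffAt ℝ 1 V p) (hη : ContDiffAt ℝ 1 η p)
    (hbox : box φ p + V p * φ p = 0) :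
    ∑ α, DD α (ZZ ε l V φ η α) p =
      η p * (2 * ε * RR p ^ (ε - 1) * (SS φ p + l * φ p) ^ 2
        + 1 / 2 * RR p ^ ε * (2 * V p + SS V p) * φ p ^ 2)
      + (AA ε l V φ p * SS η p + FF ε l φ p * fderiv ℝ η p (GG φ p)) := by
  have dη : DifferentiableAt ℝ η p := hη.differentiableAt (by norm_num)
  have dA : DifferentiableAt ℝ (AA ε l V φ) p :=
    (AA_contDiffAt hp hφ hV).differentiableAt (by norm_num)
  have dF : DifferentiableAt ℝ (FF ε l φ) p := (FF_contDiffAt hp hφ).differentiableAt (by norm_num)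
  have dD : ∀ α, DifferentiableAt ℝ (DD α φ) p := fun α =>
    (DD_contDiffAt hφ α).differentiableAt (by norm_num)
  have dηA : DifferentiableAt ℝ (fun q => η q * AA ε l V φ q) p := dη.mul dA
  have dηF : DifferentiableAt ℝ (fun q => η q * FF ε l φ q) p := dη.mul dF
  have e : ∀ α, DD α (ZZ ε l V φ η α) p = DD α (fun q => (η q * AA ε l V φ q) * yy α q) p
      + DD α (fun q => (η q * FF ε l φ q) * (mm α * DD α φ q)) p := by
    intro α
    have h1 : DifferentiableAt ℝ (fun q => (η q * AA ε l V φ q) * yy α q) p :=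
      dηA.mul (yy α).differentiableAt
    have h2 : DifferentiableAt ℝ (fun q => (η q * FF ε l φ q) * (mm α * DD α φ q)) p :=
      dηF.mul ((dD α).const_mul _)
    unfold DD ZZ
    rw [fderiv_fun_add h1 h2]
    rfl
  have hR := RR_pos hp
  simp only [e, Finset.sum_add_distrib]
  rw [div_X dηA, div_G dηF dD, fderiv_mul_app dη dA, fderiv_mul_app dη dF, fderiv_AA hp hφ hV,
    fderiv_FF hp hφ]
  have hb : box φ p = - (V p * φ p) := by linarith
  have hn : (n : ℝ) = 2 * l - 2 * ε + 1 := by rw [hl]; ring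
  rw [hb, hn]
  have r2 : RR p ^ (ε - 1) * RR p = RR p ^ ε := by
    rw [rpow_sub_one hR.ne']; field_simp
  unfold AA FF SS
  ring


/-- the cutoff -/
def eta {n : ℕ} (k : ℝ) (q : Spacetime n) : ℝ :=
  smoothTransition (2 + log (RR q) / k) * smoothTransition (2 - log (‖q.2‖ ^ 2) / k)

lemma norm_pos_of_Dom {n : ℕ} {p : Spacetime n} (hp : p ∈ Dom n) : 0 < ‖p.2‖ :=
  lt_of_le_of_lt (abs_nonneg _) hp

lemma st_contDiff : ContDiff ℝ 1 smoothTransition := by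
  exact_mod_cast smoothTransition.contDiff (n := 1)

lemma st_deriv_bound : ∃ M : ℝ, 0 < M ∧ ∀ x, 0 ≤ deriv smoothTransition x ∧
    deriv smoothTransition x ≤ M ∧ (1 < x → deriv smoothTransition x = 0) := by
  have hc : Continuous (deriv smoothTransition) := st_contDiff.continuous_deriv (by norm_num)
  have h1 : ∀ x, 1 < x → deriv smoothTransition x = 0 := by
    intro x hx
    have : smoothTransition =ᶠ[nhds x] fun _ => 1 := by
      filter_upwards [lt_mem_nhds hx] with y hy
      exact smoothTransition.one_of_one_le hy.le
    rw [this.deriv_eq]; simp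
  have h0 : ∀ x, x < 0 → deriv smoothTransition x = 0 := by
    intro x hx
    have : smoothTransition =ᶠ[nhds x] fun _ => 0 := by
      filter_upwards [gt_mem_nhds hx] with y hy
      exact smoothTransition.zero_of_nonpos hy.le
    rw [this.deriv_eq]; simp
  obtain ⟨M, hM⟩ := (isCompact_Icc (a := (0:ℝ)) (b := 1)).exists_bound_of_continuousOn
    hc.continuousOn
  refine ⟨|M| + 1, by positivity, fun x => ⟨smoothTransition.monotone.deriv_nonneg, ?_, h1 x⟩⟩
  by_cases hx0 : x < 0
  · rw [h0 x hx0]; positivity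
  by_cases hx1 : 1 < x
  · rw [h1 x hx1]; positivity
  have := hM x ⟨not_lt.1 hx0, not_lt.1 hx1⟩
  have h2 := le_abs_self (deriv smoothTransition x)
  rw [Real.norm_eq_abs] at this
  linarith [le_abs_self M]

lemma eta_contDiffAt {n : ℕ} (k : ℝ) {p : Spacetime n} (hp : p ∈ Dom n) :
    ContDiffAt ℝ 1 (eta k) p := by
  have h1 : ContDiffAt ℝ 1 (RR : Spacetime n → ℝ) p := RR_contDiff.contDiffAt.of_le (by norm_num)
  have h2 : ContDiffAt ℝ 1 (fun q : Spacetime n => ‖q.2‖ ^ 2) p :=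
    (contDiff_snd.norm_sq ℝ).contDiffAt
  have hr : ‖p.2‖ ^ 2 ≠ 0 := (pow_pos (norm_pos_of_Dom hp) 2).ne'
  unfold eta
  exact (st_contDiff.contDiffAt.comp p
      (contDiffAt_const.add ((h1.log (RR_pos hp).ne').div_const k))).mul
    (st_contDiff.contDiffAt.comp p
      (contDiffAt_const.sub ((h2.log hr).div_const k)))

lemma fderiv_eta {n : ℕ} (k : ℝ) {p : Spacetime n} (hp : p ∈ Dom n) (v : Spacetime n) :
    fderiv ℝ (eta k) p v =
      (deriv smoothTransition (2 + log (RR p) / k) * smoothTransition (2 - log (‖p.2‖ ^ 2) / k)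
        * (fderiv ℝ RR p v / RR p)
      - smoothTransition (2 + log (RR p) / k) * deriv smoothTransition (2 - log (‖p.2‖ ^ 2) / k)
        * (2 * inner ℝ p.2 v.2 / ‖p.2‖ ^ 2)) / k := by
  have d1 : DifferentiableAt ℝ (RR : Spacetime n → ℝ) p :=
    RR_contDiff.contDiffAt.differentiableAt (by norm_num)
  have hr : ‖p.2‖ ^ 2 ≠ 0 := (pow_pos (norm_pos_of_Dom hp) 2).ne'
  have h2 : HasFDerivAt (fun q : Spacetime n => ‖q.2‖ ^ 2)
      (2 • (innerSL ℝ p.2).comp (ContinuousLinearMap.snd ℝ ℝ (EuclideanSpace ℝ (Fin n)))) p :=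
    hasFDerivAt_snd.norm_sq
  have hst : ∀ x, HasDerivAt smoothTransition (deriv smoothTransition x) x := fun x =>
    (st_contDiff.differentiable (by norm_num) x).hasDerivAt
  have l1 := ((d1.hasFDerivAt.log (RR_pos hp).ne').mul_const k⁻¹).const_add 2
  have l2 := ((h2.log hr).mul_const k⁻¹).const_sub 2
  have m1 := (hst (2 + log (RR p) * k⁻¹)).comp_hasFDerivAt p l1
  have m2 := (hst (2 - log (‖p.2‖ ^ 2) * k⁻¹)).comp_hasFDerivAt p l2
  have m := m1.mul m2
  have e : fderiv ℝ (eta k) p = _ := m.fderiv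
  rw [e]
  simp
  field_simp
  ring

lemma eta_nonneg {n : ℕ} (k : ℝ) (p : Spacetime n) : 0 ≤ eta k p :=
  mul_nonneg (smoothTransition.nonneg _) (smoothTransition.nonneg _)

/-- compact set carrying the cutoff -/
def KK (n : ℕ) (k : ℝ) : Set (Spacetime n) := {p | ‖p.2‖ ^ 2 ≤ exp (2 * k) ∧ exp (-(2 * k)) ≤ RR p}

lemma RR_Dom {n : ℕ} {p : Spacetime n} (h : 0 < RR p) : p ∈ Dom n := by
  unfold RR at h
  have : p.1 ^ 2 < ‖p.2‖ ^ 2 := by linarith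
  exact abs_lt_of_sq_lt_sq this (norm_nonneg _)

lemma KK_sub (n : ℕ) (k : ℝ) : KK n k ⊆ Dom n := fun _ hp => RR_Dom ((exp_pos _).trans_le hp.2)

lemma KK_compact (n : ℕ) (k : ℝ) : IsCompact (KK n k) := by
  have hcl : IsClosed (KK n k) := by
    apply IsClosed.inter
    · exact isClosed_le (f := fun p : Spacetime n => ‖p.2‖ ^ 2) (g := fun _ => exp (2 * k))
        (by fun_prop) (by fun_prop)
    · exact isClosed_le (f := fun _ => exp (-(2 * k))) (by fun_prop) RR_contDiff.continuous
  apply Metric.isCompact_of_isClosed_isBounded hcl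
  refine (Metric.isBounded_closedBall (x := (0 : Spacetime n)) (r := exp k)).subset ?_
  intro p hp
  rw [mem_closedBall_zero_iff, Prod.norm_def]
  have h1 : ‖p.2‖ ≤ exp k := by
    have : ‖p.2‖ ^ 2 ≤ (exp k) ^ 2 := by
      rw [← exp_nat_mul]; exact_mod_cast hp.1
    exact le_of_sq_le_sq this (exp_pos _).le
  have h2 : |p.1| < ‖p.2‖ := KK_sub n k hp
  exact max_le (by rw [Real.norm_eq_abs]; linarith) h1

lemma eta_zero {n : ℕ} {k : ℝ} (hk : 0 < k) {p : Spacetime n} (hp : p ∈ Dom n) (hK : p ∉ KK n k) :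
    eta k p = 0 := by
  unfold eta
  by_cases h1 : ‖p.2‖ ^ 2 ≤ exp (2 * k)
  · have h2 : RR p < exp (-(2 * k)) := by
      by_contra h
      exact hK ⟨h1, not_lt.1 h⟩
    have : log (RR p) < -(2 * k) := (log_lt_iff_lt_exp (RR_pos hp)).2 h2
    have : log (RR p) / k < -2 := by rw [div_lt_iff₀ hk]; linarith
    rw [smoothTransition.zero_of_nonpos (by linarith), zero_mul]
  · have : 2 * k < log (‖p.2‖ ^ 2) :=
      (lt_log_iff_exp_lt (pow_pos (norm_pos_of_Dom hp) 2)).2 (not_le.1 h1)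
    have : 2 < log (‖p.2‖ ^ 2) / k := by rw [lt_div_iff₀ hk]; linarith
    rw [smoothTransition.zero_of_nonpos (x := 2 - _) (by linarith), mul_zero]

/-- the global current -/
def ZC {n : ℕ} (ε l : ℝ) (V φ : Spacetime n → ℝ) (k : ℝ) (α : Option (Fin n)) :
    Spacetime n → ℝ := (Dom n).indicator (ZZ ε l V φ (eta k) α)

lemma ZC_zero {n : ℕ} {ε l : ℝ} {V φ : Spacetime n → ℝ} {k : ℝ} (hk : 0 < k) (α : Option (Fin n))
    {p : Spacetime n} (hK : p ∉ KK n k) : ZC ε l V φ k α p = 0 := by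
  unfold ZC
  by_cases hp : p ∈ Dom n
  · rw [Set.indicator_of_mem hp, ZZ, eta_zero hk hp hK]; ring
  · rw [Set.indicator_of_notMem hp]

lemma ZC_contDiff {n : ℕ} {ε l : ℝ} {V φ : Spacetime n → ℝ} {k : ℝ} (hk : 0 < k)
    (hφ : ContDiffOn ℝ 2 φ (Dom n)) (hV : ContDiffOn ℝ 1 V (Dom n)) (α : Option (Fin n)) :
    ContDiff ℝ 1 (ZC ε l V φ k α) := by
  rw [contDiff_iff_contDiffAt]
  intro p
  by_cases hp : p ∈ Dom n
  · have hn := (isOpen_Dom n).mem_nhds hp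
    refine (ZZ_contDiffAt (ε := ε) (l := l) hp (hφ.contDiffAt hn) (hV.contDiffAt hn)
      (eta_contDiffAt k hp) α).congr_of_eventuallyEq ?_
    filter_upwards [hn] with q hq
    exact Set.indicator_of_mem hq _
  · have hpK : p ∉ KK n k := fun h => hp (KK_sub n k h)
    refine (contDiffAt_const (c := (0:ℝ))).congr_of_eventuallyEq ?_
    filter_upwards [(KK_compact n k).isClosed.isOpen_compl.mem_nhds hpK] with q hq
    exact ZC_zero hk α hq

lemma ZC_DD {n : ℕ} {ε l : ℝ} {V φ : Spacetime n → ℝ} {k : ℝ} (α : Option (Fin n))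
    {p : Spacetime n} (hp : p ∈ Dom n) :
    DD α (ZC ε l V φ k α) p = DD α (ZZ ε l V φ (eta k) α) p := by
  unfold DD
  have : ZC ε l V φ k α =ᶠ[nhds p] ZZ ε l V φ (eta k) α := by
    filter_upwards [(isOpen_Dom n).mem_nhds hp] with q hq
    exact Set.indicator_of_mem hq _
  rw [this.fderiv_eq]

lemma ZC_DD_zero {n : ℕ} {ε l : ℝ} {V φ : Spacetime n → ℝ} {k : ℝ} (hk : 0 < k)
    (α : Option (Fin n)) {p : Spacetime n} (hp : p ∉ Dom n) :
    DD α (ZC ε l V φ k α) p = 0 := by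
  unfold DD
  have hpK : p ∉ KK n k := fun h => hp (KK_sub n k h)
  have : ZC ε l V φ k α =ᶠ[nhds p] fun _ => 0 := by
    filter_upwards [(KK_compact n k).isClosed.isOpen_compl.mem_nhds hpK] with q hq
    exact ZC_zero hk α hq
  rw [this.fderiv_eq]
  simp

lemma integral_DD {n : ℕ} {f : Spacetime n → ℝ} (hf : ContDiff ℝ 1 f) (hc : HasCompactSupport f)
    (α : Option (Fin n)) : Integrable (DD α f) ∧ ∫ p, DD α f p = 0 := by
  have h1 : Integrable f := hf.continuous.integrable_of_hasCompactSupport hc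
  have hcont : Continuous (DD α f) := (hf.continuous_fderiv (by norm_num)).clm_apply continuous_const
  have h2 : Integrable (DD α f) := by
    refine hcont.integrable_of_hasCompactSupport ?_
    exact hc.fderiv_apply (𝕜 := ℝ) (EE α)
  refine ⟨h2, ?_⟩
  have : (volume : Measure (Spacetime n)).IsAddHaarMeasure := by
    change ((volume : Measure ℝ).prod volume).IsAddHaarMeasure
    infer_instance
  have := integral_mul_fderiv_eq_neg_fderiv_mul_of_integrable (μ := (volume : Measure (Spacetime n)))
    (f := fun _ => (1:ℝ)) (g := f) (v := EE α) (by simp) (by simp only [one_mul]; exact h2) (by simpa using h1)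
    (fun _ _ => by fun_prop) (fun x _ => hf.differentiable (by norm_num) x)
  simpa [DD] using this


lemma SS_eq {n : ℕ} (φ : Spacetime n → ℝ) {p : Spacetime n} (hp : p ∈ Dom n) :
    SS φ p = p.1 * dt φ p + ‖p.2‖ * dr φ p := by
  have hr := norm_pos_of_Dom hp
  unfold SS dr
  rw [fderiv_self, Fintype.sum_option, mul_div_cancel₀ _ hr.ne']
  rfl

lemma BB_eq {n : ℕ} (φ : Spacetime n → ℝ) (p : Spacetime n) :
    BB φ p = - dt φ p ^ 2 + dr φ p ^ 2 + angSq φ p := by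
  unfold BB angSq
  rw [Fintype.sum_option]
  have : ∀ i : Fin n, DD (some i) φ p = dx i φ p := fun i => rfl
  have h0 : DD none φ p = dt φ p := rfl
  simp only [this, h0, mm, one_mul, pow_two]
  ring

lemma angSq_nonneg {n : ℕ} (φ : Spacetime n → ℝ) {p : Spacetime n} (hp : p ∈ Dom n) :
    0 ≤ angSq φ p := by
  have hr := norm_pos_of_Dom hp
  unfold angSq dr
  rw [div_pow, sub_nonneg, div_le_iff₀ (by positivity), EuclideanSpace.norm_sq_eq, mul_comm]
  simpa using Finset.sum_mul_sq_le_sq_mul_sq Finset.univ (fun i => p.2 i) (fun i => dx i φ p)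

lemma inner_GG {n : ℕ} (φ : Spacetime n → ℝ) {p : Spacetime n} (hp : p ∈ Dom n) :
    inner ℝ p.2 (GG φ p).2 = ‖p.2‖ * dr φ p := by
  have hr := norm_pos_of_Dom hp
  unfold dr
  rw [mul_div_cancel₀ _ hr.ne', PiLp.inner_apply]
  refine Finset.sum_congr rfl fun i _ => ?_
  have : (GG φ p).2 i = dx i φ p := by
    have := yy_GG φ p (some i)
    rw [yy_some] at this
    rw [this]
    simp [mm, DD, dx, EE]
  rw [this]
  simp [mul_comm]

/-- the elementary inequality for the error terms -/
lemma err_bound {c1 c2 M K Ω f S Y W Ra th l ε : ℝ} (h1 : 0 ≤ c1) (h1' : c1 ≤ M) (h2 : 0 ≤ c2)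
    (h2' : c2 ≤ M) (hl : 0 ≤ l) (hε : 0 ≤ ε) (hΩ : 0 ≤ Ω) (hK : 0 ≤ K)
    (hf : |f| ≤ K * Ω) (hS : |S| ≤ K * Ω) (hY : |Y| ≤ K * Ω) (hW : 0 ≤ W) (hW' : W ≤ (K * Ω) ^ 2)
    (hR : 0 ≤ Ra) (hR' : c1 * Ra ≤ M * (K * Ω) ^ 2) (hth : |th| ≤ 1) :
    -(M * (K * Ω) ^ 2 * (l * ε + 4 + 2 * l)) ≤
      (c1 - c2) * (l * ε * f ^ 2 + 1 / 2 * W - 1 / 2 * (S ^ 2 - Y ^ 2 + Ra))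
        + (S + l * f) * (c1 * S - c2 * (S - th * Y)) := by
  set J := K * Ω with hJ
  have hJ0 : 0 ≤ J := mul_nonneg hK hΩ
  have hM : 0 ≤ M := h1.trans h1'
  have f2 : f ^ 2 ≤ J ^ 2 := sq_le_sq' (abs_le.1 hf).1 (abs_le.1 hf).2
  have S2 : S ^ 2 ≤ J ^ 2 := sq_le_sq' (abs_le.1 hS).1 (abs_le.1 hS).2
  have Y2 : Y ^ 2 ≤ J ^ 2 := sq_le_sq' (abs_le.1 hY).1 (abs_le.1 hY).2
  have hc : |c1 - c2| ≤ M := abs_le.2 ⟨by linarith, by linarith⟩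
  have hle : 0 ≤ l * ε := mul_nonneg hl hε
  have hb : |l * ε * f ^ 2 + 1 / 2 * W - 1 / 2 * (S ^ 2 - Y ^ 2)| ≤ J ^ 2 * (l * ε + 3 / 2) := by
    have g1 := mul_le_mul_of_nonneg_left f2 hle
    have g2 := mul_nonneg hle (sq_nonneg f)
    rw [abs_le]; constructor <;> nlinarith [sq_nonneg S, sq_nonneg Y]
  have t1 : |(c1 - c2) * (l * ε * f ^ 2 + 1 / 2 * W - 1 / 2 * (S ^ 2 - Y ^ 2))|
      ≤ M * (J ^ 2 * (l * ε + 3 / 2)) := by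
    rw [abs_mul]; exact mul_le_mul hc hb (abs_nonneg _) hM
  have n1 : |S + l * f| ≤ J * (1 + l) := by
    calc |S + l * f| ≤ |S| + |l * f| := abs_add_le _ _
      _ = |S| + l * |f| := by rw [abs_mul, abs_of_nonneg hl]
      _ ≤ J + l * J := by gcongr
      _ = _ := by ring
  have n2 : |c1 * S - c2 * (S - th * Y)| ≤ 2 * M * J := by
    calc |c1 * S - c2 * (S - th * Y)| = |(c1 - c2) * S + c2 * (th * Y)| := by ring_nf
      _ ≤ |(c1 - c2) * S| + |c2 * (th * Y)| := abs_add_le _ _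
      _ = |c1 - c2| * |S| + c2 * (|th| * |Y|) := by
        rw [abs_mul, abs_mul, abs_mul, abs_of_nonneg h2]
      _ ≤ M * J + M * (1 * J) := by gcongr
      _ = _ := by ring
  have t2 : |(S + l * f) * (c1 * S - c2 * (S - th * Y))| ≤ J * (1 + l) * (2 * M * J) := by
    rw [abs_mul]; exact mul_le_mul n1 n2 (abs_nonneg _) (by positivity)
  have t3 : (c1 - c2) * Ra ≤ M * J ^ 2 := by nlinarith [mul_nonneg h2 hR]
  have a1 := (abs_le.1 t1).1
  have a2 := (abs_le.1 t2).1
  nlinarith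

/-- weight -/
def ww {n : ℕ} (p : Spacetime n) : ℝ := (1 + |uu p|) * (1 + |vv p|)

lemma ww_pos {n : ℕ} (p : Spacetime n) : 0 < ww p := by unfold ww; positivity

lemma RR_uv {n : ℕ} {p : Spacetime n} (hp : p ∈ Dom n) : RR p = 4 * |uu p * vv p| := by
  have h : uu p * vv p = - (RR p / 4) := by unfold uu vv RR; ring
  rw [h, abs_neg, abs_of_pos (by linarith [RR_pos hp])]; ring

lemma gg_eq {n : ℕ} {ε δ : ℝ} {p : Spacetime n} (hp : p ∈ Dom n) :
    gg n ε δ p = RR p ^ (ε - 1) * (ww p ^ (-(((n : ℝ) - 1 + δ) / 2))) ^ 2 := by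
  have h : |p.1| < ‖p.2‖ := hp
  have hw := ww_pos p
  unfold gg gprof
  rw [if_pos h, ← rpow_natCast (ww p ^ _), ← rpow_mul hw.le]
  have e : -(((n : ℝ) - 1 + δ) / 2) * ((2 : ℕ) : ℝ) = -((n : ℝ) - 1 + δ) := by
    push_cast; ring
  rw [e]
  rfl

lemma le_of_weight {w e C x : ℝ} (hw : 0 < w) (h : w ^ e * x ≤ C) : x ≤ C * w ^ (-e) := by
  rw [rpow_neg hw.le, ← div_eq_mul_inv, le_div_iff₀ (rpow_pos_of_pos hw e), mul_comm]
  exact h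

/-- all decay bounds collected with one constant -/
lemma decay_bounds {n : ℕ} {δ : ℝ} {V φ : Spacetime n → ℝ}
    (hVbd : ∃ C : ℝ, ∀ q ∈ Dom n, |V q| ≤ C)
    (hVpos : ∀ q ∈ Dom n, 0 < V q)
    (hdec : Dec δ φ)
    (hextra : ∃ C : ℝ, ∀ q ∈ Dom n, 1 < |uu q * vv q| →
      ((1 + |uu q|) * (1 + |vv q|)) ^ (((n : ℝ) - 1 + δ) / 2) *
        |uu q * vv q| ^ ((1 : ℝ) / 2) * (V q) ^ ((1 : ℝ) / 2) * |φ q| ≤ C) :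
    ∃ K : ℝ, 0 < K ∧ ∀ p ∈ Dom n,
      |φ p| ≤ K * ww p ^ (-(((n : ℝ) - 1 + δ) / 2)) ∧
      |p.1 * dt φ p + ‖p.2‖ * dr φ p| ≤ K * ww p ^ (-(((n : ℝ) - 1 + δ) / 2)) ∧
      |‖p.2‖ * dt φ p + p.1 * dr φ p| ≤ K * ww p ^ (-(((n : ℝ) - 1 + δ) / 2)) ∧
      RR p * V p * φ p ^ 2 ≤ (K * ww p ^ (-(((n : ℝ) - 1 + δ) / 2))) ^ 2 ∧
      (RR p < 1 → RR p * angSq φ p ≤ (K * ww p ^ (-(((n : ℝ) - 1 + δ) / 2))) ^ 2) := by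
  obtain ⟨C0, h0⟩ := hVbd
  obtain ⟨⟨C1, h1⟩, ⟨C2, h2⟩, ⟨C3, h3⟩⟩ := hdec
  obtain ⟨C4, h4⟩ := hextra
  set K := 1 + |C1| + 2 * |C2| + |C3| * (1 + 2 * √|C0|) + 2 * |C4| with hKdef
  have hs0 : 0 ≤ √|C0| := sqrt_nonneg _
  have hs2 : √|C0| ^ 2 = |C0| := sq_sqrt (abs_nonneg _)
  have p1 := abs_nonneg C1
  have p2 := abs_nonneg C2
  have p3 := abs_nonneg C3
  have p4 := abs_nonneg C4
  have p5 := mul_nonneg p3 hs0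
  have K1 : C1 ≤ K := by rw [hKdef]; linarith [le_abs_self C1]
  have K2 : 2 * |C2| ≤ K := by rw [hKdef]; linarith
  have K3 : C3 ≤ K := by rw [hKdef]; linarith [le_abs_self C3]
  have K3' : |C3| * (2 * √|C0|) ≤ K := by rw [hKdef]; linarith
  have K4 : 2 * |C4| ≤ K := by rw [hKdef]; linarith
  have hK : 0 < K := by rw [hKdef]; linarith
  refine ⟨K, hK, fun p hp => ?_⟩
  set e := ((n : ℝ) - 1 + δ) / 2 with he
  have hw := ww_pos p
  set Ω := ww p ^ (-e) with hΩdef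
  have hΩ : 0 < Ω := rpow_pos_of_pos hw _
  have hR := RR_pos hp
  have hRuv := RR_uv hp
  have hV := hVpos p hp
  have b1 : |uu p * du φ p| + |vv p * dv φ p| ≤ K * Ω :=
    (le_of_weight hw (h1 p hp)).trans (by gcongr)
  have b3 : |φ p| ≤ C3 * Ω := le_of_weight hw (h3 p hp)
  have b3' : |φ p| ≤ |C3| * Ω := b3.trans (by gcongr; exact le_abs_self _)
  refine ⟨b3.trans (by gcongr), ?_, ?_, ?_, ?_⟩
  · have : p.1 * dt φ p + ‖p.2‖ * dr φ p = uu p * du φ p + vv p * dv φ p := by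
      unfold uu vv du dv; ring
    rw [this]
    exact (abs_add_le _ _).trans b1
  · have : ‖p.2‖ * dt φ p + p.1 * dr φ p = vv p * dv φ p - uu p * du φ p := by
      unfold uu vv du dv; ring
    rw [this]
    exact (abs_sub _ _).trans (by linarith)
  · by_cases hc : 1 < |uu p * vv p|
    · have b4 := h4 p hp hc
      rw [mul_assoc, mul_assoc, ← sqrt_eq_rpow, ← sqrt_eq_rpow] at b4
      have b5 := le_of_weight hw b4
      have b6 : (√|uu p * vv p| * (√(V p) * |φ p|)) ^ 2 ≤ (|C4| * Ω) ^ 2 := by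
        apply pow_le_pow_left₀ (by positivity)
        exact b5.trans (by gcongr; exact le_abs_self _)
      rw [mul_pow, mul_pow, sq_sqrt (abs_nonneg _), sq_sqrt hV.le, sq_abs] at b6
      calc RR p * V p * φ p ^ 2 = 4 * (|uu p * vv p| * (V p * φ p ^ 2)) := by rw [hRuv]; ring
        _ ≤ 4 * (|C4| * Ω) ^ 2 := by gcongr
        _ = (2 * |C4| * Ω) ^ 2 := by ring
        _ ≤ (K * Ω) ^ 2 := by gcongr
    · have hR4 : RR p ≤ 4 := by linarith
      have hV0 : V p ≤ |C0| := (le_abs_self _).trans ((h0 p hp).trans (le_abs_self _))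
      have : φ p ^ 2 ≤ (|C3| * Ω) ^ 2 := by
        rw [← sq_abs (φ p)]; gcongr
      calc RR p * V p * φ p ^ 2 ≤ 4 * |C0| * (|C3| * Ω) ^ 2 := by gcongr
        _ = (|C3| * (2 * √|C0|) * Ω) ^ 2 := by
          linear_combination (-4 * |C3| ^ 2 * Ω ^ 2) * hs2
        _ ≤ (K * Ω) ^ 2 := by gcongr
  · intro hR1
    have b2 := h2 p hp (by linarith)
    rw [mul_assoc, ← sqrt_eq_rpow] at b2
    have b5 := le_of_weight hw b2
    have b6 : (√|uu p * vv p| * √(angSq φ p)) ^ 2 ≤ (|C2| * Ω) ^ 2 := by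
      apply pow_le_pow_left₀ (by positivity)
      exact b5.trans (by gcongr; exact le_abs_self _)
    rw [mul_pow, sq_sqrt (abs_nonneg _), sq_sqrt (angSq_nonneg φ hp)] at b6
    calc RR p * angSq φ p = 4 * (|uu p * vv p| * angSq φ p) := by rw [hRuv]; ring
      _ ≤ 4 * (|C2| * Ω) ^ 2 := by gcongr
      _ = (2 * |C2| * Ω) ^ 2 := by ring
      _ ≤ (K * Ω) ^ 2 := by gcongr


lemma pointwise_bound {n : ℕ} (hn : 2 ≤ n) {δ μ ε l : ℝ} (hε : 0 < ε)
    (hl : l = ((n : ℝ) - 1) / 2 + ε) {V φ : Spacetime n → ℝ}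
    (hV1 : ContDiffOn ℝ 1 V (Dom n))
    (hVbd : ∃ C : ℝ, ∀ q ∈ Dom n, |V q| ≤ C)
    (hVpos : ∀ q ∈ Dom n, 0 < V q)
    (hVmono : ∀ q ∈ Dom n, q.1 * dt V q + ‖q.2‖ * dr V q > (-2 + μ) * V q)
    (hφ : ContDiffOn ℝ 2 φ (Dom n))
    (heq : ∀ q ∈ Dom n, box φ q + V q * φ q = 0)
    (hdec : Dec δ φ)
    (hextra : ∃ C : ℝ, ∀ q ∈ Dom n, 1 < |uu q * vv q| →
      ((1 + |uu q|) * (1 + |vv q|)) ^ (((n : ℝ) - 1 + δ) / 2) *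
        |uu q * vv q| ^ ((1 : ℝ) / 2) * (V q) ^ ((1 : ℝ) / 2) * |φ q| ≤ C) :
    ∃ C : ℝ, 0 < C ∧ ∀ k : ℝ, 0 < k → ∀ p ∈ Dom n,
      eta k p * (1 / 2 * μ * (RR p ^ ε * (V p * φ p ^ 2)))
        ≤ ∑ α, DD α (ZC ε l V φ k α) p + C / k * gg n ε δ p := by
  obtain ⟨K, hK, hb⟩ := decay_bounds hVbd hVpos hdec hextra
  obtain ⟨M, hM, hst⟩ := st_deriv_bound
  have hn' : (2:ℝ) ≤ n := by exact_mod_cast hn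
  have hl0 : 0 ≤ l := by rw [hl]; linarith
  refine ⟨2 * (M * K ^ 2 * (l * ε + 4 + 2 * l)), by positivity, fun k hk p hp => ?_⟩
  obtain ⟨b1, b2, b3, b4, b5⟩ := hb p hp
  have hnb := (isOpen_Dom n).mem_nhds hp
  have hr := norm_pos_of_Dom hp
  have hR := RR_pos hp
  have hVp := hVpos p hp
  have hang := angSq_nonneg φ hp
  simp only [ZC_DD _ hp]
  rw [div_ZZ hp hl (hφ.contDiffAt hnb) (hV1.contDiffAt hnb) (eta_contDiffAt k hp) (heq p hp),
    gg_eq hp]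
  set Ω := ww p ^ (-(((n : ℝ) - 1 + δ) / 2)) with hΩ
  have hΩ0 : 0 < Ω := rpow_pos_of_pos (ww_pos p) _
  have eS : SS (eta k) p = _ := fderiv_eta k hp p
  rw [eS, fderiv_eta k hp (GG φ p), fderiv_RR_self, fderiv_RR_GG, inner_GG φ hp,
    real_inner_self_eq_norm_sq]
  set c1 := deriv smoothTransition (2 + log (RR p) / k) *
    smoothTransition (2 - log (‖p.2‖ ^ 2) / k) with hc1
  set c2 := smoothTransition (2 + log (RR p) / k) *
    deriv smoothTransition (2 - log (‖p.2‖ ^ 2) / k) with hc2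
  have c1n : 0 ≤ c1 := mul_nonneg (hst _).1 (smoothTransition.nonneg _)
  have c2n : 0 ≤ c2 := mul_nonneg (smoothTransition.nonneg _) (hst _).1
  have c1M : c1 ≤ M := by
    have := mul_le_mul (hst (2 + log (RR p) / k)).2.1
      (smoothTransition.le_one (2 - log (‖p.2‖ ^ 2) / k)) (smoothTransition.nonneg _) hM.le
    linarith
  have c2M : c2 ≤ M := by
    have := mul_le_mul (smoothTransition.le_one (2 + log (RR p) / k))
      (hst (2 - log (‖p.2‖ ^ 2) / k)).2.1 (hst _).1 zero_le_one
    linarith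
  have hcR : c1 * (RR p * angSq φ p) ≤ M * (K * Ω) ^ 2 := by
    by_cases h1 : RR p < 1
    · exact mul_le_mul c1M (b5 h1) (by positivity) hM.le
    · have : 0 ≤ log (RR p) / k := div_nonneg (log_nonneg (not_lt.1 h1)) hk.le
      have : c1 = 0 := by rw [hc1, (hst _).2.2 (by linarith), zero_mul]
      rw [this, zero_mul]; positivity
  have hth : |p.1 / ‖p.2‖| ≤ 1 := by
    rw [abs_div, abs_of_pos hr, div_le_one hr]
    exact le_of_lt hp
  have hSe := SS_eq φ hp
  have err := err_bound c1n c1M c2n c2M hl0 hε.le hΩ0.le hK.le b1 b2 b3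
    (by positivity : 0 ≤ RR p * V p * φ p ^ 2) b4 (by positivity : 0 ≤ RR p * angSq φ p) hcR hth
  have hSV := SS_eq V hp
  have hmono := hVmono p hp
  rw [← hSV] at hmono
  have r2 : RR p ^ (ε - 1) * RR p = RR p ^ ε := by
    rw [rpow_sub_one hR.ne']; field_simp
  have hw1 : 0 < RR p ^ (ε - 1) := rpow_pos_of_pos hR _
  have hw2 : 0 < RR p ^ ε := rpow_pos_of_pos hR _
  have heta := eta_nonneg k p
  have main : eta k p * (1 / 2 * μ * (RR p ^ ε * (V p * φ p ^ 2))) ≤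
      eta k p * (2 * ε * RR p ^ (ε - 1) * (SS φ p + l * φ p) ^ 2
        + 1 / 2 * RR p ^ ε * (2 * V p + SS V p) * φ p ^ 2) := by
    apply mul_le_mul_of_nonneg_left _ heta
    have h1 : 0 ≤ 2 * ε * RR p ^ (ε - 1) * (SS φ p + l * φ p) ^ 2 := by positivity
    have h2 : 0 ≤ RR p ^ ε * φ p ^ 2 * (2 * V p + SS V p - μ * V p) :=
      mul_nonneg (by positivity) (by linarith)
    linarith
  have e1 : fderiv ℝ φ p p = SS φ p := rfl
  rw [e1]
  have eB := BB_eq φ p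
  have hRd : RR p = ‖p.2‖ ^ 2 - p.1 ^ 2 := rfl
  have key : AA ε l V φ p * ((c1 * (2 * RR p / RR p) - c2 * (2 * ‖p.2‖ ^ 2 / ‖p.2‖ ^ 2)) / k)
      + FF ε l φ p * ((c1 * (2 * SS φ p / RR p) - c2 * (2 * (‖p.2‖ * dr φ p) / ‖p.2‖ ^ 2)) / k)
      = 2 / k * RR p ^ (ε - 1) * ((c1 - c2) * (l * ε * φ p ^ 2 + 1 / 2 * (RR p * V p * φ p ^ 2)
        - 1 / 2 * ((p.1 * dt φ p + ‖p.2‖ * dr φ p) ^ 2 - (‖p.2‖ * dt φ p + p.1 * dr φ p) ^ 2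
          + RR p * angSq φ p))
        + ((p.1 * dt φ p + ‖p.2‖ * dr φ p) + l * φ p) * (c1 * (p.1 * dt φ p + ‖p.2‖ * dr φ p)
          - c2 * ((p.1 * dt φ p + ‖p.2‖ * dr φ p)
            - p.1 / ‖p.2‖ * (‖p.2‖ * dt φ p + p.1 * dr φ p)))) := by
    unfold AA FF
    rw [← r2, hSe, eB]
    have q1 : 2 * RR p / RR p = 2 := by field_simp
    have q2 : 2 * ‖p.2‖ ^ 2 / ‖p.2‖ ^ 2 = 2 := by field_simp
    have q3 : RR p * (2 * (‖p.2‖ * dr φ p) / ‖p.2‖ ^ 2) = 2 * ((p.1 * dt φ p + ‖p.2‖ * dr φ p)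
            - p.1 / ‖p.2‖ * (‖p.2‖ * dt φ p + p.1 * dr φ p)) := by
      rw [hRd]; field_simp; ring
    have q4 : RR p * (2 * (p.1 * dt φ p + ‖p.2‖ * dr φ p) / RR p)
        = 2 * (p.1 * dt φ p + ‖p.2‖ * dr φ p) := by field_simp
    have q5 : (p.1 * dt φ p + ‖p.2‖ * dr φ p) ^ 2 - (‖p.2‖ * dt φ p + p.1 * dr φ p) ^ 2
        = RR p * (-dt φ p ^ 2 + dr φ p ^ 2) := by rw [hRd]; ring
    rw [q1, q2, q5]
    set b := 2 * (‖p.2‖ * dr φ p) / ‖p.2‖ ^ 2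
    set s := p.1 * dt φ p + ‖p.2‖ * dr φ p
    set z := s - p.1 / ‖p.2‖ * (‖p.2‖ * dt φ p + p.1 * dr φ p)
    linear_combination (RR p ^ (ε - 1) * (s + l * φ p) * c1 / k) * q4
      - (RR p ^ (ε - 1) * (s + l * φ p) * c2 / k) * q3
  rw [key]
  have h5 := mul_le_mul_of_nonneg_left err (by positivity : 0 ≤ 2 / k * RR p ^ (ε - 1))
  have h6 : 2 / k * RR p ^ (ε - 1) * -(M * (K * Ω) ^ 2 * (l * ε + 4 + 2 * l))
      = - (2 * (M * K ^ 2 * (l * ε + 4 + 2 * l)) / k * (RR p ^ (ε - 1) * Ω ^ 2)) := by ring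
  rw [h6] at h5
  linarith

lemma eta_one {n : ℕ} {k : ℝ} (hk : 0 < k) {p : Spacetime n} (h1 : -k ≤ log (RR p))
    (h2 : log (‖p.2‖ ^ 2) ≤ k) : eta k p = 1 := by
  have h1' : -1 ≤ log (RR p) / k := by rw [le_div_iff₀ hk]; linarith
  have h2' : log (‖p.2‖ ^ 2) / k ≤ 1 := by rw [div_le_iff₀ hk]; linarith
  unfold eta
  rw [smoothTransition.one_of_one_le (by linarith), smoothTransition.one_of_one_le (by linarith)]
  ring

/-- **Theorem 1.6** (unique continuation for `□φ + Vφ = 0` with monotone positive `V`):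
if `V ∈ C¹(D) ∩ L^∞(D)` is positive with `(u∂_u + v∂_v)(log V) > −2 + μ`
(equivalently `t·∂_t V + r·∂_r V > (−2+μ)V`), and a `C²` solution `φ` satisfies the decay
conditions `Dec(δ)` together with the extra weighted decay on `{|uv| > 1}`, then `φ ≡ 0` on `D`. -/
theorem uc_strong (n : ℕ) (hn : 2 ≤ n) (δ μ : ℝ) (hδ : 0 < δ) (hμ : 0 < μ)
    (V φ : Spacetime n → ℝ)
    (hV1 : ContDiffOn ℝ 1 V (Dom n))
    (hVbd : ∃ C : ℝ, ∀ q ∈ Dom n, |V q| ≤ C)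
    (hVpos : ∀ q ∈ Dom n, 0 < V q)
    (hVmono : ∀ q ∈ Dom n, q.1 * dt V q + ‖q.2‖ * dr V q > (-2 + μ) * V q)
    (hφ : ContDiffOn ℝ 2 φ (Dom n))
    (heq : ∀ q ∈ Dom n, box φ q + V q * φ q = 0)
    (hdec : Dec δ φ)
    (hextra : ∃ C : ℝ, ∀ q ∈ Dom n, 1 < |uu q * vv q| →
      ((1 + |uu q|) * (1 + |vv q|)) ^ (((n : ℝ) - 1 + δ) / 2) *
        |uu q * vv q| ^ ((1 : ℝ) / 2) * (V q) ^ ((1 : ℝ) / 2) * |φ q| ≤ C) :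
    ∀ q ∈ Dom n, φ q = 0 := by
  intro q0 hq0
  by_contra hne
  set ε := δ / 2 with hεd
  have hε : 0 < ε := by rw [hεd]; linarith
  have hεδ : ε < δ := by rw [hεd]; linarith
  set l := ((n : ℝ) - 1) / 2 + ε with hl
  obtain ⟨C, hC, hpt⟩ := pointwise_bound hn hε hl hV1 hVbd hVpos hVmono hφ heq hdec hextra
  have hgI := gg_integrable n hn hε hεδ
  set I := ∫ p, gg n ε δ p with hI
  have hnb := (isOpen_Dom n).mem_nhds hq0
  set Q : Spacetime n → ℝ := fun p => 1 / 2 * μ * (RR p ^ ε * (V p * φ p ^ 2)) with hQ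
  have hQ0 : 0 < Q q0 := by
    have h1 := hVpos q0 hq0
    have h2 := rpow_pos_of_pos (RR_pos hq0) ε
    have h3 : 0 < φ q0 ^ 2 := by positivity
    simp only [hQ]
    positivity
  have hQc : ContinuousAt Q q0 := by
    have h1 : ContinuousAt V q0 := (hV1.contDiffAt hnb).continuousAt
    have h2 : ContinuousAt φ q0 := (hφ.contDiffAt hnb).continuousAt
    have h3 := (RR_rpow_contDiffAt hq0 ε).continuousAt
    exact continuousAt_const.mul (h3.mul (h1.mul (h2.pow 2)))
  set k0 := 1 + |log (RR q0)| + |log (‖q0.2‖ ^ 2)| with hk0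
  have hk0p : 0 < k0 := by positivity
  have hlog1 : ContinuousAt (fun p : Spacetime n => log (RR p)) q0 :=
    RR_contDiff.continuous.continuousAt.log (RR_pos hq0).ne'
  have hlog2 : ContinuousAt (fun p : Spacetime n => log (‖p.2‖ ^ 2)) q0 := by
    have : ContinuousAt (fun p : Spacetime n => ‖p.2‖ ^ 2) q0 := by fun_prop
    exact this.log (pow_pos (norm_pos_of_Dom hq0) 2).ne'
  have ev1 : ∀ᶠ p in nhds q0, Q q0 / 2 < Q p := hQc.eventually (lt_mem_nhds (by linarith))
  have ev2 : ∀ᶠ p in nhds q0, -k0 < log (RR p) :=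
    hlog1.eventually (lt_mem_nhds (by
      have := neg_abs_le (log (RR q0))
      have := abs_nonneg (log (‖q0.2‖ ^ 2))
      linarith))
  have ev3 : ∀ᶠ p in nhds q0, log (‖p.2‖ ^ 2) < k0 :=
    hlog2.eventually (gt_mem_nhds (by
      have := le_abs_self (log (‖q0.2‖ ^ 2))
      have := abs_nonneg (log (RR q0))
      linarith))
  have ev4 : ∀ᶠ p in nhds q0, p ∈ Dom n := hnb
  obtain ⟨s, hs, hball⟩ := Metric.eventually_nhds_iff_ball.1 (ev1.and (ev2.and (ev3.and ev4)))
  set B := Metric.ball q0 s with hB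
  have hBfin : volume B ≠ ⊤ := by
    have hsub : B ⊆ Metric.closedBall q0 s := Metric.ball_subset_closedBall
    exact ((measure_mono hsub).trans_lt (isCompact_closedBall q0 s).measure_lt_top).ne
  have hBpos : 0 < volume.real B := by
    rw [Measure.real, ENNReal.toReal_pos_iff]
    exact ⟨Metric.measure_ball_pos volume q0 hs, hBfin.lt_top⟩
  set c := Q q0 / 2 with hc
  have hcp : 0 < c := by rw [hc]; linarith
  have hfinal : ∀ k, k0 ≤ k → c * volume.real B ≤ C / k * I := by
    intro k hk
    have hkp : 0 < k := hk0p.trans_le hk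
    have hD : ∀ α, Integrable (DD α (ZC ε l V φ k α)) ∧ ∫ p, DD α (ZC ε l V φ k α) p = 0 :=
      fun α => integral_DD (ZC_contDiff hkp hφ hV1 α)
        (HasCompactSupport.intro (KK_compact n k) fun p hp => ZC_zero hkp α hp) α
    have hDi : Integrable (fun p => ∑ α, DD α (ZC ε l V φ k α) p) :=
      integrable_finsetSum _ fun α _ => (hD α).1
    have hD0 : ∫ p, ∑ α, DD α (ZC ε l V φ k α) p = 0 := by
      rw [integral_finsetSum _ fun α _ => (hD α).1]
      exact Finset.sum_eq_zero fun α _ => (hD α).2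
    have hle : ∫ p, B.indicator (fun _ => c) p
        ≤ ∫ p, (∑ α, DD α (ZC ε l V φ k α) p + C / k * gg n ε δ p) := by
      apply integral_mono
      · exact (integrable_indicator_iff Metric.isOpen_ball.measurableSet).2
          (integrableOn_const hBfin)
      · exact hDi.add (hgI.const_mul _)
      · intro p
        change B.indicator (fun _ => c) p ≤ ∑ α, DD α (ZC ε l V φ k α) p + C / k * gg n ε δ p
        by_cases hp : p ∈ Dom n
        · have h1 := hpt k hkp p hp
          by_cases hpB : p ∈ B
          · obtain ⟨g1, g2, g3, _⟩ := hball p hpB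
            rw [Set.indicator_of_mem hpB]
            rw [eta_one hkp (by linarith) (by linarith), one_mul] at h1
            exact g1.le.trans h1
          · rw [Set.indicator_of_notMem hpB]
            refine le_trans ?_ h1
            have := hVpos p hp
            have := RR_pos hp
            have := eta_nonneg k p
            positivity
        · have hpB : p ∉ B := fun h => hp (hball p h).2.2.2
          rw [Set.indicator_of_notMem hpB, Finset.sum_eq_zero fun α _ => ZC_DD_zero hkp α hp,
            zero_add]
          exact mul_nonneg (by positivity) (gprof_nonneg _ _ _ _ _)
    rw [integral_add hDi (hgI.const_mul _), hD0, zero_add, integral_const_mul,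
      integral_indicator Metric.isOpen_ball.measurableSet, setIntegral_const, smul_eq_mul] at hle
    linarith
  have hI0 : 0 ≤ I := integral_nonneg fun p => gprof_nonneg _ _ _ _ _
  have hx : 0 < c * volume.real B := mul_pos hcp hBpos
  have key : ∀ x : ℝ, 0 < x → (∀ k, k0 ≤ k → x ≤ C / k * I) → False := by
    intro x hx hf
    have hy : 0 ≤ C * I / x := by positivity
    have hz := hf (k0 + C * I / x) (by linarith)
    have hkk : 0 < k0 + C * I / x := by linarith
    have e1 : C / (k0 + C * I / x) * I = C * I / (k0 + C * I / x) := by ring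
    rw [e1, le_div_iff₀ hkk, mul_add, mul_div_cancel₀ _ hx.ne'] at hz
    have := mul_pos hx hk0p
    linarith
  exact key _ hx fun k hk => hfinal k (by linarith)
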